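/- arXiv:2311.15504 — 10 statements merged into one kernel-verified Lean document; each statement's English description precedes it below -/
import Mathlib

section
/- For every h > 0, every x₀ ∈ ℝ, every n ∈ ℕ and every tuple of real data f₀, …, f_n, there exists a unique polynomial P ∈ ℝ[X] of degree at most n such that (1/h)·∫_{I_k} P(ξ) dξ = f_k for every k = 0, …, n. -/
open Polynomial in
/-- The linear map sending a polynomial to its integrals over the intervals `[a k, b k]`. -/
noncomputable def intervalIntegrals {ι : Type*} (a b : ι → ℝ) : ℝ[X] →ₗ[ℝ] (ι → ℝ) where
  toFun P k := ∫ ξ in (a k)..(b k), P.eval ξ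
  map_add' P Q := by
    ext k
    simp only [eval_add, Pi.add_apply]
    exact intervalIntegral.integral_add (P.continuous.intervalIntegrable _ _)
      (Q.continuous.intervalIntegrable _ _)
  map_smul' c P := by
    ext k
    simp [eval_smul]

open Polynomial in
theorem integral_eval_derivative (Q : ℝ[X]) (a b : ℝ) :
    ∫ ξ in a..b, (derivative Q).eval ξ = Q.eval b - Q.eval a :=
  intervalIntegral.integral_eq_sub_of_hasDerivAt (fun x _ => Q.hasDerivAt x)
    ((derivative Q).continuous.intervalIntegrable _ _)

open Polynomial in
/-- On consecutive intervals with distinct endpoints `y 0, …, y (n + 1)`, integrals of polynomials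
of degree at most `n` can be prescribed arbitrarily. -/
theorem exists_natDegree_le_forall_integral_eq {n : ℕ} {y : ℕ → ℝ}
    (hy : Function.Injective y) (g : ℕ → ℝ) :
    ∃ P : ℝ[X], P.natDegree ≤ n ∧ ∀ k ≤ n, ∫ ξ in (y k)..(y (k + 1)), P.eval ξ = g k := by
  set F : ℕ → ℝ := fun j => ∑ i ∈ Finset.range j, g i with hF
  set Q := Lagrange.interpolate (Finset.range (n + 2)) y F
  have hQ : ∀ j < n + 2, Q.eval (y j) = F j := fun j hj =>
    Lagrange.eval_interpolate_at_node F hy.injOn (Finset.mem_range.2 hj)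
  have hdeg : Q.natDegree ≤ n + 1 := by
    have hle := Lagrange.degree_interpolate_le (s := Finset.range (n + 2)) F hy.injOn
    rw [Finset.card_range] at hle
    exact natDegree_le_of_degree_le hle
  refine ⟨derivative Q, (natDegree_derivative_le Q).trans (by omega), fun k hk => ?_⟩
  rw [integral_eval_derivative, hQ _ (by omega), hQ _ (by omega), hF]
  simp [Finset.sum_range_succ]

open Polynomial in
/-- A polynomial of degree at most `n` is determined by its integrals over consecutive intervals
with distinct endpoints `y 0, …, y (n + 1)`. -/
theorem eq_of_forall_integral_eq {n : ℕ} {y : ℕ → ℝ} (hy : Function.Injective y) {P Q : ℝ[X]}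
    (hP : P.natDegree ≤ n) (hQ : Q.natDegree ≤ n)
    (hPQ : ∀ k ≤ n, ∫ ξ in (y k)..(y (k + 1)), P.eval ξ = ∫ ξ in (y k)..(y (k + 1)), Q.eval ξ) :
    P = Q := by
  have mem_iff : ∀ R : ℝ[X], R ∈ degreeLT ℝ (n + 1) ↔ R.natDegree ≤ n := fun R => by
    rw [degreeLT_succ_eq_degreeLE, mem_degreeLE, natDegree_le_iff_degree_le]
  let T : degreeLT ℝ (n + 1) →ₗ[ℝ] (Fin (n + 1) → ℝ) :=
    (intervalIntegrals (fun k : Fin (n + 1) => y k) (fun k => y (k + 1))).domRestrict _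
  have hsurj : Function.Surjective T := fun g => by
    obtain ⟨R, hR, hRg⟩ := exists_natDegree_le_forall_integral_eq (n := n) hy
      (fun k => g (Fin.ofNat (n + 1) k))
    refine ⟨⟨R, (mem_iff R).2 hR⟩, funext fun k => ?_⟩
    simpa [T, intervalIntegrals] using hRg k (Nat.lt_succ_iff.1 k.2)
  have : FiniteDimensional ℝ (degreeLT ℝ (n + 1)) :=
    (degreeLTEquiv ℝ (n + 1)).symm.finiteDimensional
  have hinj : Function.Injective T :=
    (LinearMap.injective_iff_surjective_of_finrank_eq_finrank
      (degreeLTEquiv ℝ (n + 1)).finrank_eq).2 hsurj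
  exact congrArg Subtype.val (@hinj ⟨P, (mem_iff P).2 hP⟩ ⟨Q, (mem_iff Q).2 hQ⟩
    (funext fun k => hPQ k (Nat.lt_succ_iff.1 k.2)))


/-- For every `h > 0`, every `x₀ ∈ ℝ`, every `n ∈ ℕ` and every tuple of real data
`f 0, …, f n`, there exists a unique polynomial `P ∈ ℝ[X]` of degree at most `n`
such that `(1/h) ∫_{I_k} P = f k` for every `k = 0, …, n`, where
`I_k = [x₀ + k h − h/2, x₀ + k h + h/2]`. -/
theorem cell_average_reconstruction_exists_unique
    (h x₀ : ℝ) (hh : 0 < h) (n : ℕ) (f : ℕ → ℝ) :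
    ∃! P : Polynomial ℝ, P.natDegree ≤ n ∧
      ∀ k ≤ n, (1 / h) *
        (∫ ξ in (x₀ + (k : ℝ) * h - h / 2)..(x₀ + (k : ℝ) * h + h / 2), P.eval ξ) = f k := by
  set y : ℕ → ℝ := fun k => x₀ + (k : ℝ) * h - h / 2 with hy
  have hinj : Function.Injective y := fun i j hij => by
    have hmul : (i : ℝ) * h = j * h := by simp only [hy] at hij; linarith
    exact_mod_cast mul_right_cancel₀ hh.ne' hmul
  have hright : ∀ k : ℕ, x₀ + (k : ℝ) * h + h / 2 = y (k + 1) := fun k => by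
    simp only [hy]; push_cast; ring
  have havg : ∀ (I : ℝ) (k : ℕ), 1 / h * I = f k ↔ I = h * f k := fun I k => by
    rw [one_div, inv_mul_eq_iff_eq_mul₀ hh.ne']
  simp only [hright, havg]
  obtain ⟨P, hP, hPf⟩ :=
    exists_natDegree_le_forall_integral_eq (n := n) hinj (fun k => h * f k)
  exact ⟨P, ⟨hP, hPf⟩, fun Q ⟨hQ, hQf⟩ =>
    eq_of_forall_integral_eq hinj hQ hP fun k hk => (hQf k hk).trans (hPf k hk).symm⟩
end

section
/- Let P ∈ ℝ[X] be the cell-average reconstruction of the data f₀, …, f_n on n+1 uniform cells of width h, i.e. deg P ≤ n and (1/h)·∫_{I_k} P(ξ) dξ = f_k for k = 0, …, n. Then the n-th derivative of P is a constant function and satisfies P⁽ⁿ⁾ · hⁿ = ∑_{k=0}^{n} (−1)^{n−k} · choose(n,k) · f_k; equivalently, the ENO-MR smoothness indicator |P⁽ⁿ⁾| · hⁿ of the stencil equals the absolute value of the n-th finite difference of the data. -/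
open Polynomial in
/-- The `n`-th forward difference of a polynomial `P` of degree at most `n` is the constant
`n! • P.coeff n`. -/
theorem Polynomial.fwdDiff_iter_eval_of_natDegree_le {R : Type*} [CommRing R] {n : ℕ} {P : R[X]}
    (hP : P.natDegree ≤ n) (y : R) :
    (fwdDiff 1)^[n] P.eval y = n.factorial * P.coeff n := by
  rcases hP.lt_or_eq with hlt | rfl
  · rw [Polynomial.fwdDiff_iter_eq_zero_of_degree_lt hlt, coeff_eq_zero_of_natDegree_lt hlt]
    simp
  · rw [Polynomial.fwdDiff_iter_degree_eq_factorial]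
    simp [mul_comm]

open Polynomial in
/-- The `n`-th finite difference with step `h` of a polynomial `P` of degree at most `n`. -/
theorem Polynomial.sum_choose_mul_eval_add_mul {R : Type*} [CommRing R] {n : ℕ} {P : R[X]}
    (hP : P.natDegree ≤ n) (h y : R) :
    ∑ k ∈ Finset.range (n + 1), (-1 : R) ^ (n - k) * (n.choose k : R) * P.eval (y + k * h) =
      n.factorial * P.coeff n * h ^ n := by
  have hcoeff : (taylor y P).coeff n = P.coeff n := by
    rcases hP.lt_or_eq with hlt | rfl
    · rw [coeff_eq_zero_of_natDegree_lt hlt,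
        coeff_eq_zero_of_natDegree_lt ((natDegree_taylor P y).trans_lt hlt)]
    · exact coeff_taylor_natDegree y P
  have hQ : ((taylor y P).comp (C h * X)).natDegree ≤ n := by
    have hlin : (C h * X).natDegree ≤ 1 := (natDegree_C_mul_le h X).trans natDegree_X_le
    refine natDegree_comp_le.trans ((Nat.mul_le_mul ?_ hlin).trans_eq (mul_one n))
    rwa [natDegree_taylor]
  rw [mul_assoc, ← hcoeff, ← comp_C_mul_X_coeff, ← fwdDiff_iter_eval_of_natDegree_le hQ 0,
    fwdDiff_iter_eq_sum_shift]
  refine Finset.sum_congr rfl fun k _ => ?_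
  simp [zsmul_eq_mul, taylor_eval, add_comm y, mul_comm h]

open Polynomial in
/-- The `n`-th derivative of a polynomial `P` of degree at most `n` is the constant
`n! • P.coeff n`. -/
theorem Polynomial.iterate_derivative_of_natDegree_le {R : Type*} [CommRing R] {n : ℕ} {P : R[X]}
    (hP : P.natDegree ≤ n) :
    derivative^[n] P = C (n.factorial * P.coeff n) := by
  have hd : (derivative^[n] P).natDegree = 0 := by
    have := natDegree_iterate_derivative P n
    omega
  rw [eq_C_of_natDegree_eq_zero hd, coeff_iterate_derivative]
  simp [Nat.descFactorial_self]

/-- If `P` is the cell-average reconstruction of the data `f 0, …, f n` on `n+1`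
uniform cells of width `h`, then the `n`-th derivative of `P` is a constant polynomial,
and `P⁽ⁿ⁾ · hⁿ = ∑_{k=0}^{n} (−1)^{n−k} (n choose k) f k`. -/
theorem eno_mr_smoothness_indicator_eq_finite_difference
    (h x₀ : ℝ) (hh : 0 < h) (n : ℕ) (f : ℕ → ℝ) (P : Polynomial ℝ)
    (hdeg : P.natDegree ≤ n)
    (havg : ∀ k ≤ n, (1 / h) *
      (∫ ξ in (x₀ + (k : ℝ) * h - h / 2)..(x₀ + (k : ℝ) * h + h / 2), P.eval ξ) = f k) :
    (∃ c : ℝ, Polynomial.derivative^[n] P = Polynomial.C c) ∧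
    ∀ x : ℝ, ((Polynomial.derivative^[n] P).eval x) * h ^ n =
      ∑ k ∈ Finset.range (n + 1), (-1 : ℝ) ^ (n - k) * (n.choose k : ℝ) * f k := by
  have hder := Polynomial.iterate_derivative_of_natDegree_le hdeg
  refine ⟨⟨_, hder⟩, fun x => ?_⟩
  rw [hder, Polynomial.eval_C]
  have hint : ∀ k : ℕ, (∫ ξ in (x₀ + (k : ℝ) * h - h / 2)..(x₀ + (k : ℝ) * h + h / 2), P.eval ξ) =
      ∫ t in (-(h / 2))..(h / 2), P.eval (x₀ + t + k * h) := by
    intro k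
    have := intervalIntegral.integral_comp_add_left (a := -(h / 2)) (b := h / 2)
      (fun ξ => P.eval ξ) (x₀ + k * h)
    rw [sub_eq_add_neg, ← this]
    simp only [add_right_comm]
  calc (n.factorial * P.coeff n) * h ^ n
      = (1 / h) * ∫ _ in (-(h / 2))..(h / 2), (n.factorial * P.coeff n) * h ^ n := by
        rw [intervalIntegral.integral_const, smul_eq_mul]
        field_simp
        ring
    _ = (1 / h) * ∫ t in (-(h / 2))..(h / 2), ∑ k ∈ Finset.range (n + 1),
          (-1 : ℝ) ^ (n - k) * (n.choose k : ℝ) * P.eval (x₀ + t + k * h) := by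
        simp only [Polynomial.sum_choose_mul_eval_add_mul hdeg]
    _ = ∑ k ∈ Finset.range (n + 1), (-1 : ℝ) ^ (n - k) * (n.choose k : ℝ) * f k := by
        rw [intervalIntegral.integral_finsetSum fun k _ =>
          Continuous.intervalIntegrable (by fun_prop) _ _, Finset.mul_sum]
        refine Finset.sum_congr rfl fun k hk => ?_
        rw [intervalIntegral.integral_const_mul, ← hint,
          ← havg k (Nat.lt_succ_iff.mp (Finset.mem_range.mp hk))]
        ring
end

section
/- Let n ∈ ℕ, h > 0, x₀ ∈ ℝ, and let H : ℝ → ℝ be (n+1)-times continuously differentiable on [x₀ − h/2, x₀ + n·h + h/2] with |H⁽ⁿ⁺¹⁾(ξ)| ≤ M on that interval. Set f_k = (1/h)·∫_{I_k} H(ξ) dξ for k = 0, …, n, and let P be the cell-average reconstruction of f₀, …, f_n. Then there exists a constant C depending only on n (not on h, x₀, H, M) such that |P(x) − H(x)| ≤ C·M·h^{n+1} for every x ∈ [x₀ − h/2, x₀ + n·h + h/2]. -/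
/-- A function that is `m` times continuously differentiable on `[a, b]`, has `m` distinct zeros
there and has `m`-th derivative bounded by `M`, is bounded by `M * (b - a) ^ m`. -/
theorem abs_le_mul_pow_of_zeros {a b M : ℝ} (hab : a < b) (m : ℕ) (f : ℝ → ℝ)
    (hf : ContDiffOn ℝ m f (Set.Icc a b)) (z : ℕ → ℝ)
    (hz : ∀ i < m, z i ∈ Set.Icc a b ∧ f (z i) = 0)
    (hlt : ∀ i, i + 1 < m → z i < z (i + 1))
    (hM : ∀ x ∈ Set.Icc a b, |iteratedDerivWithin m f (Set.Icc a b) x| ≤ M) :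
    ∀ x ∈ Set.Icc a b, |f x| ≤ M * (b - a) ^ m := by
  induction m generalizing f z with
  | zero => simpa using hM
  | succ m ih =>
    have hu : UniqueDiffOn ℝ (Set.Icc a b) := uniqueDiffOn_Icc hab
    have hf' : ContDiffOn ℝ m (derivWithin f (Set.Icc a b)) (Set.Icc a b) :=
      hf.derivWithin hu (by norm_cast)
    have rolle : ∀ i, ∃ c, i < m →
        c ∈ Set.Ioo (z i) (z (i + 1)) ∧ derivWithin f (Set.Icc a b) c = 0 := by
      intro i
      by_cases hi : i < m
      · obtain ⟨hi₁, hi₂⟩ := hz i (by omega)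
        obtain ⟨hj₁, hj₂⟩ := hz (i + 1) (by omega)
        obtain ⟨c, hc, hc'⟩ := exists_deriv_eq_zero (hlt i (by omega))
          (hf.continuousOn.mono (Set.Icc_subset_Icc hi₁.1 hj₁.2)) (hi₂.trans hj₂.symm)
        refine ⟨c, fun _ ↦ ⟨hc, ?_⟩⟩
        rwa [derivWithin_of_mem_nhds
          (Icc_mem_nhds (hi₁.1.trans_lt hc.1) (hc.2.trans_le hj₁.2))]
      · exact ⟨0, fun h ↦ absurd h hi⟩
    choose w hw using rolle
    have bound := ih (derivWithin f (Set.Icc a b)) hf' w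
      (fun i hi ↦ ⟨⟨(hz i (by omega)).1.1.trans (hw i hi).1.1.le,
        (hw i hi).1.2.le.trans (hz (i + 1) (by omega)).1.2⟩, (hw i hi).2⟩)
      (fun i hi ↦ (hw i (by omega)).1.2.trans (hw (i + 1) hi).1.1)
      (by simpa only [iteratedDerivWithin_succ'] using hM)
    intro x hx
    obtain ⟨h₀, h₀'⟩ := hz 0 (by omega)
    have mvt := Convex.norm_image_sub_le_of_norm_derivWithin_le
      (hf.differentiableOn (by norm_cast)) bound (convex_Icc a b) h₀ hx
    rw [h₀', sub_zero, Real.norm_eq_abs, Real.norm_eq_abs] at mvt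
    refine mvt.trans ?_
    rw [pow_succ, ← mul_assoc]
    exact mul_le_mul_of_nonneg_left
      (abs_le.2 ⟨by linarith [hx.1, h₀.2], by linarith [hx.2, h₀.1]⟩)
      ((abs_nonneg _).trans (bound x hx))

theorem Polynomial.iteratedDeriv_eval (P : Polynomial ℝ) (k : ℕ) :
    iteratedDeriv k (fun x ↦ P.eval x) = fun x ↦ (Polynomial.derivative^[k] P).eval x := by
  induction k generalizing P with
  | zero => simp
  | succ k ih =>
    rw [iteratedDeriv_succ', Function.iterate_succ_apply, ← ih]
    congr 1
    ext x
    exact P.deriv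

/-- Two continuous functions with the same integral over `[a, b]` agree somewhere in `(a, b)`. -/
theorem exists_eq_of_intervalIntegral_eq {a b : ℝ} (hab : a < b) {f g : ℝ → ℝ}
    (hf : ContinuousOn f (Set.Icc a b)) (hg : ContinuousOn g (Set.Icc a b))
    (hfg : ∫ x in a..b, f x = ∫ x in a..b, g x) :
    ∃ c ∈ Set.Ioo a b, f c = g c := by
  rw [← Set.uIcc_of_le hab.le] at hf hg
  obtain ⟨c, hc, h⟩ := exists_eq_interval_average hab.ne (hf.sub hg)
  rw [Set.uIoo_of_lt hab] at hc
  refine ⟨c, hc, sub_eq_zero.1 (h.trans ?_)⟩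
  simp only [Pi.sub_apply]
  rw [interval_average_eq, intervalIntegral.integral_sub hf.intervalIntegrable
    hg.intervalIntegrable, hfg, sub_self, smul_zero]

/-- The cell-average reconstruction polynomial on a smooth `(n+1)`-cell stencil is an
`(n+1)`-th-order accurate approximation: there is a constant `C` depending only on `n`
such that `|P(x) − H(x)| ≤ C · M · h^(n+1)` on the stencil, whenever `H` is
`(n+1)`-times continuously differentiable there with `|H⁽ⁿ⁺¹⁾| ≤ M`. -/
theorem cell_average_reconstruction_high_order_accuracy (n : ℕ) :
    ∃ C : ℝ, 0 < C ∧ ∀ (h x₀ : ℝ), 0 < h → ∀ (H : ℝ → ℝ) (M : ℝ),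
      ContDiffOn ℝ (n + 1) H (Set.Icc (x₀ - h / 2) (x₀ + (n : ℝ) * h + h / 2)) →
      (∀ ξ ∈ Set.Icc (x₀ - h / 2) (x₀ + (n : ℝ) * h + h / 2),
        |iteratedDerivWithin (n + 1) H (Set.Icc (x₀ - h / 2) (x₀ + (n : ℝ) * h + h / 2)) ξ| ≤ M) →
      ∀ P : Polynomial ℝ, P.natDegree ≤ n →
      (∀ k ≤ n, (1 / h) *
          (∫ ξ in (x₀ + (k : ℝ) * h - h / 2)..(x₀ + (k : ℝ) * h + h / 2), P.eval ξ) =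
        (1 / h) *
          (∫ ξ in (x₀ + (k : ℝ) * h - h / 2)..(x₀ + (k : ℝ) * h + h / 2), H ξ)) →
      ∀ x ∈ Set.Icc (x₀ - h / 2) (x₀ + (n : ℝ) * h + h / 2),
        |P.eval x - H x| ≤ C * M * h ^ (n + 1) := by
  refine ⟨((n : ℝ) + 1) ^ (n + 1), by positivity, ?_⟩
  intro h x₀ hh H M hH hM P hP hint
  set a := x₀ - h / 2 with ha
  set b := x₀ + (n : ℝ) * h + h / 2 with hb
  have hlen : b - a = ((n : ℝ) + 1) * h := by rw [ha, hb]; ring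
  have hab : a < b := sub_pos.1 (hlen ▸ by positivity)
  have hPc : ContDiff ℝ (n + 1) (fun x ↦ P.eval x) := by
    simpa using P.contDiff_aeval (𝕜 := ℝ) (n + 1)
  have cell : ∀ k : ℕ, k ≤ n →
      a ≤ x₀ + (k : ℝ) * h - h / 2 ∧ x₀ + (k : ℝ) * h + h / 2 ≤ b := by
    intro k hk
    have hk' : (k : ℝ) * h ≤ n * h := by gcongr
    have hk₀ : 0 ≤ (k : ℝ) * h := by positivity
    constructor <;> linarith
  have zeros : ∀ k : ℕ, ∃ c, k ≤ n →
      c ∈ Set.Ioo (x₀ + (k : ℝ) * h - h / 2) (x₀ + (k : ℝ) * h + h / 2) ∧ P.eval c = H c := by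
    intro k
    by_cases hk : k ≤ n
    · obtain ⟨c, hc⟩ := exists_eq_of_intervalIntegral_eq
        (a := x₀ + (k : ℝ) * h - h / 2) (b := x₀ + (k : ℝ) * h + h / 2) (by linarith)
        (f := fun x ↦ P.eval x) P.continuous.continuousOn
        (hH.continuousOn.mono (Set.Icc_subset_Icc (cell k hk).1 (cell k hk).2))
        (mul_left_cancel₀ (one_div_pos.2 hh).ne' (hint k hk))
      exact ⟨c, fun _ ↦ hc⟩
    · exact ⟨0, fun h ↦ absurd h hk⟩
  choose z hz using zeros
  intro x hx
  have key := abs_le_mul_pow_of_zeros (M := M) hab (n + 1) ((fun x ↦ P.eval x) - H)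
    (by exact_mod_cast hPc.contDiffOn.sub hH) z
    (fun i hi ↦ by
      obtain ⟨hi₁, hi₂⟩ := hz i (by omega)
      have hc := cell i (by omega)
      exact ⟨⟨hc.1.trans hi₁.1.le, hi₁.2.le.trans hc.2⟩, sub_eq_zero.2 hi₂⟩)
    (fun i hi ↦ by
      have h₁ := (hz i (by omega)).1.2
      have h₂ := (hz (i + 1) (by omega)).1.1
      push_cast at h₂
      linarith)
    (fun y hy ↦ by
      have hu : UniqueDiffOn ℝ (Set.Icc a b) := uniqueDiffOn_Icc hab
      rw [iteratedDerivWithin_sub hy hu (by exact_mod_cast hPc.contDiffWithinAt)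
        (by exact_mod_cast hH y hy),
        iteratedDerivWithin_eq_iteratedDeriv hu (by exact_mod_cast hPc.contDiffAt) hy,
        P.iteratedDeriv_eval, Polynomial.iterate_derivative_eq_zero (by omega)]
      simpa using hM y hy)
    x hx
  calc |P.eval x - H x| ≤ M * (b - a) ^ (n + 1) := key
    _ = ((n : ℝ) + 1) ^ (n + 1) * M * h ^ (n + 1) := by rw [hlen, mul_pow]; ring
end

section
/- For every h > 0, every n ∈ ℕ and every polynomial f ∈ ℝ[X] with deg f ≤ n, there exists a unique polynomial H ∈ ℝ[X] with deg H ≤ n such that (1/h)·∫_{x−h/2}^{x+h/2} H(ξ) dξ = f(x) for all x ∈ ℝ. In other words, the sliding-average operator H ↦ (x ↦ (1/h)·∫_{x−h/2}^{x+h/2} H(ξ) dξ) is a bijection on the space of real polynomials of degree at most n. -/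
open Polynomial in
/-- The sliding average of a nonzero polynomial differs from it by a polynomial of smaller
degree. -/
lemma Polynomial.exists_slidingAverage_eq_add (h : ℝ) (hh : 0 < h) {p : ℝ[X]} (hp : p ≠ 0) :
    ∃ r : ℝ[X], r.degree < p.degree ∧
      ∀ x : ℝ, (1 / h) * (∫ ξ in (x - h / 2)..(x + h / 2), p.eval ξ) = p.eval x + r.eval x := by
  let c : ℕ → ℝ := fun i => (1 / h) * ∫ t in (-(h / 2))..(h / 2), t ^ i
  have hc : c 0 = 1 := by
    simp [c, hh.ne']
  refine ⟨∑ i ∈ Finset.range p.natDegree, c (i + 1) • hasseDeriv (i + 1) p, ?_, fun x => ?_⟩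
  · rw [degree_eq_natDegree hp, degree_lt_iff_coeff_zero]
    intro j hj
    rw [finsetSum_coeff]
    refine Finset.sum_eq_zero fun i _ => ?_
    rw [coeff_smul, hasseDeriv_coeff, coeff_eq_zero_of_natDegree_lt (by omega)]
    simp
  · have hshift : ∫ ξ in (x - h / 2)..(x + h / 2), p.eval ξ =
        ∫ t in (-(h / 2))..(h / 2), (taylor x p).eval t := by
      simp only [taylor_eval]
      rw [intervalIntegral.integral_comp_add_right (fun ξ => p.eval ξ) x]
      congr 1 <;> ring
    have hexp : ∀ t : ℝ, (taylor x p).eval t =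
        ∑ i ∈ Finset.range (p.natDegree + 1), (hasseDeriv i p).eval x * t ^ i := fun t => by
      rw [eval_eq_sum_range, natDegree_taylor]
      simp only [taylor_coeff]
    rw [hshift]
    simp only [hexp]
    rw [intervalIntegral.integral_finsetSum
      (fun i _ => Continuous.intervalIntegrable (by fun_prop) _ _)]
    simp only [intervalIntegral.integral_const_mul]
    have hsum : (1 / h) * ∑ i ∈ Finset.range (p.natDegree + 1),
          (hasseDeriv i p).eval x * ∫ t in (-(h / 2))..(h / 2), t ^ i =
        ∑ i ∈ Finset.range (p.natDegree + 1), c i * (hasseDeriv i p).eval x := by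
      rw [Finset.mul_sum]
      exact Finset.sum_congr rfl fun i _ => by simp only [c]; ring
    rw [hsum, Finset.sum_range_succ', hc, eval_finsetSum]
    simp [add_comm]

open Polynomial in
lemma Polynomial.slidingAverage_sub (h : ℝ) (p q : ℝ[X]) (x : ℝ) :
    (1 / h) * (∫ ξ in (x - h / 2)..(x + h / 2), (p - q).eval ξ) =
      (1 / h) * (∫ ξ in (x - h / 2)..(x + h / 2), p.eval ξ) -
        (1 / h) * (∫ ξ in (x - h / 2)..(x + h / 2), q.eval ξ) := by
  simp only [eval_sub]
  rw [intervalIntegral.integral_sub (p.continuous.intervalIntegrable _ _)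
    (q.continuous.intervalIntegrable _ _), mul_sub]

open Polynomial in
lemma Polynomial.eq_zero_of_slidingAverage_eq_zero (h : ℝ) (hh : 0 < h) (p : ℝ[X])
    (hp : ∀ x : ℝ, (1 / h) * (∫ ξ in (x - h / 2)..(x + h / 2), p.eval ξ) = 0) : p = 0 := by
  by_contra hne
  obtain ⟨r, hr, hpr⟩ := exists_slidingAverage_eq_add h hh hne
  have hsum : p + r = 0 := Polynomial.funext fun x => by
    rw [eval_add, ← hpr x, hp x, eval_zero]
  rw [eq_neg_of_add_eq_zero_left hsum, degree_neg] at hr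
  exact lt_irrefl _ hr

open Polynomial in
lemma Polynomial.exists_slidingAverage_eq (h : ℝ) (hh : 0 < h) (m : ℕ) (f : ℝ[X])
    (hf : f.degree < m) :
    ∃ H : ℝ[X], H.degree < m ∧
      ∀ x : ℝ, (1 / h) * (∫ ξ in (x - h / 2)..(x + h / 2), H.eval ξ) = f.eval x := by
  induction m generalizing f with
  | zero =>
    have hf0 : f = 0 := by simpa using hf
    exact ⟨0, by simp, by simp [hf0]⟩
  | succ m ih =>
    by_cases hf0 : f = 0
    · exact ⟨0, by simp, by simp [hf0]⟩
    obtain ⟨r, hr, hfr⟩ := exists_slidingAverage_eq_add h hh hf0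
    have hfm : f.degree ≤ m := by
      rw [degree_eq_natDegree hf0] at hf ⊢
      exact_mod_cast Nat.lt_succ_iff.mp (by exact_mod_cast hf)
    obtain ⟨G, hG, hGr⟩ := ih r (hr.trans_le hfm)
    refine ⟨f - G, (degree_sub_le f G).trans_lt (max_lt hf (hG.trans ?_)), fun x => ?_⟩
    · exact_mod_cast Nat.lt_succ_self m
    · rw [slidingAverage_sub, hfr, hGr, add_sub_cancel_right]

/-- For every `h > 0`, `n ∈ ℕ` and polynomial `f` of degree at most `n`, there is a
unique polynomial `H` of degree at most `n` whose sliding average of width `h`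
equals `f`: `(1/h) ∫_{x−h/2}^{x+h/2} H(ξ) dξ = f(x)` for all `x`.  In particular the
sliding-average operator is a bijection on polynomials of degree at most `n`. -/
theorem sliding_average_bijective_on_polynomials
    (h : ℝ) (hh : 0 < h) (n : ℕ) (f : Polynomial ℝ) (hf : f.natDegree ≤ n) :
    ∃! H : Polynomial ℝ, H.natDegree ≤ n ∧
      ∀ x : ℝ, (1 / h) * (∫ ξ in (x - h / 2)..(x + h / 2), H.eval ξ) = f.eval x := by
  obtain ⟨H, hH, hHf⟩ := Polynomial.exists_slidingAverage_eq h hh (n + 1) f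
    (Polynomial.degree_lt_iff_coeff_zero _ _ |>.mpr fun j hj =>
      Polynomial.coeff_eq_zero_of_natDegree_lt (by omega))
  refine ⟨H, ⟨?_, hHf⟩, fun G hG => ?_⟩
  · rw [Polynomial.natDegree_le_iff_coeff_eq_zero]
    exact fun j hj => (Polynomial.degree_lt_iff_coeff_zero _ _).mp hH j hj
  · refine sub_eq_zero.mp (Polynomial.eq_zero_of_slidingAverage_eq_zero h hh _ fun x => ?_)
    rw [Polynomial.slidingAverage_sub, hG.2, hHf, sub_self]
end

section
/- Let n_c ≥ 0 be an integer, let x ∈ ℝ, and let f : ℝ → ℝ be (n_c+1)-times continuously differentiable on a neighborhood of x with f⁽ⁱ⁾(x) = 0 for all 1 ≤ i ≤ n_c. Then there exist constants C > 0 and h₀ > 0 such that IS₀(f, x, h) ≤ C · h^{n_c + 1} for all h ∈ (0, h₀); i.e., at a critical point of order n_c the baseline smoothness indicator is O(h^{n_c+1}). -/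
/-- The baseline smoothness indicator `IS₀` of ENO-MR. -/
noncomputable def IS0 (f : ℝ → ℝ) (x h : ℝ) : ℝ :=
  min (max |f x - f (x - h)| |f x - 2 * f (x - h) + f (x - 2 * h)|)
      (max |f x - f (x + h)| |f x - 2 * f (x + h) + f (x + 2 * h)|)

theorem taylorWithinEval_eq_of_iteratedDeriv_eq_zero {n : ℕ} {x y : ℝ} {f : ℝ → ℝ} {s : Set ℝ}
    (hs : UniqueDiffOn ℝ s) (hx : x ∈ s) (hf : ContDiffAt ℝ n f x)
    (hcrit : ∀ i : ℕ, 1 ≤ i → i ≤ n → iteratedDeriv i f x = 0) :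
    taylorWithinEval f n s x y = f x := by
  rw [taylor_within_apply, Finset.sum_eq_single_of_mem 0 (by simp)]
  · simp
  · intro i hi hi0
    have hin : i ≤ n := Nat.lt_succ_iff.mp (Finset.mem_range.mp hi)
    rw [iteratedDerivWithin_eq_iteratedDeriv hs (hf.of_le (by exact_mod_cast hin)) hx,
      hcrit i (Nat.one_le_iff_ne_zero.mpr hi0) hin, smul_zero]

open Set in
theorem exists_abs_sub_le_pow_of_iteratedDeriv_eq_zero {n : ℕ} {x : ℝ} {f : ℝ → ℝ}
    (hf : ContDiffAt ℝ (n + 1) f x)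
    (hcrit : ∀ i : ℕ, 1 ≤ i → i ≤ n → iteratedDeriv i f x = 0) :
    ∃ C : ℝ, 0 ≤ C ∧ ∃ ε : ℝ, 0 < ε ∧ ∀ t : ℝ, 0 ≤ t → t ≤ ε →
      |f (x + t) - f x| ≤ C * t ^ (n + 1) := by
  obtain ⟨u, hu, hfu⟩ := hf.contDiffOn (m := (n + 1 : ℕ)) (by simp) (by simp)
  obtain ⟨ε, hε, hball⟩ := Metric.nhds_basis_closedBall.mem_iff.mp hu
  have hsub : Icc x (x + ε) ⊆ u := by
    refine Subset.trans ?_ hball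
    rw [Real.closedBall_eq_Icc]
    exact Icc_subset_Icc_left (by linarith)
  have hlt : x < x + ε := by linarith
  obtain ⟨C, hC⟩ := exists_taylor_mean_remainder_bound (n := n) hlt.le
    (by exact_mod_cast hfu.mono hsub)
  refine ⟨|C|, abs_nonneg C, ε, hε, fun t ht htε => ?_⟩
  have h := hC (x + t) ⟨by linarith, by linarith⟩
  rw [taylorWithinEval_eq_of_iteratedDeriv_eq_zero (uniqueDiffOn_Icc hlt)
    (left_mem_Icc.mpr hlt.le) (hf.of_le le_self_add) hcrit, Real.norm_eq_abs,
    add_sub_cancel_left] at h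
  exact h.trans (mul_le_mul_of_nonneg_right (le_abs_self C) (by positivity))

/-- At a critical point of order `n_c` (i.e. `f⁽ⁱ⁾(x) = 0` for `1 ≤ i ≤ n_c`) of an
`(n_c+1)`-times continuously differentiable function, the baseline smoothness
indicator is `O(h^{n_c+1})`. -/
theorem baseline_indicator_upper_bound_at_critical_point
    (n_c : ℕ) (x : ℝ) (f : ℝ → ℝ)
    (hf : ContDiffAt ℝ (n_c + 1) f x)
    (hcrit : ∀ i : ℕ, 1 ≤ i → i ≤ n_c → iteratedDeriv i f x = 0) :
    ∃ C : ℝ, 0 < C ∧ ∃ h₀ : ℝ, 0 < h₀ ∧ ∀ h : ℝ, 0 < h → h < h₀ →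
      IS0 f x h ≤ C * h ^ (n_c + 1) := by
  obtain ⟨C, hC, ε, hε, hbound⟩ := exists_abs_sub_le_pow_of_iteratedDeriv_eq_zero hf hcrit
  refine ⟨C * (2 + 2 ^ (n_c + 1)) + 1, by positivity, ε / 2, by positivity, fun h hh hhε => ?_⟩
  have h₁ := hbound h hh.le (by linarith)
  have h₂ := hbound (2 * h) (by linarith) (by linarith)
  rw [mul_pow] at h₂
  have hp : 0 < h ^ (n_c + 1) := by positivity
  have hCp : 0 ≤ C * h ^ (n_c + 1) := by positivity
  have hCq : 0 ≤ C * (2 ^ (n_c + 1) * h ^ (n_c + 1)) := by positivity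
  rw [abs_le] at h₁ h₂
  refine (min_le_right _ _).trans (max_le (abs_le.mpr ?_) (abs_le.mpr ?_)) <;>
    constructor <;> linarith
end

section
/- Let n_c ≥ 0 be an integer, let x ∈ ℝ, and let f : ℝ → ℝ be (n_c+1)-times continuously differentiable on a neighborhood of x with f⁽ⁱ⁾(x) = 0 for all 1 ≤ i ≤ n_c and f⁽ⁿᶜ⁺¹⁾(x) ≠ 0. Then there exist constants c > 0 and h₀ > 0 such that IS₀(f, x, h) ≥ c · h^{n_c + 1} for all h ∈ (0, h₀). -/
open scoped Topology Nat in
/-- **Taylor's theorem** at a point where the derivatives of orders `1, …, n` vanish. -/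
theorem isLittleO_sub_of_iteratedDeriv_eq_zero {n : ℕ} {x : ℝ} {f : ℝ → ℝ}
    (hf : ContDiffAt ℝ (n + 1) f x)
    (hcrit : ∀ i : ℕ, 1 ≤ i → i ≤ n → iteratedDeriv i f x = 0) :
    (fun y ↦ f y - f x - ((n + 1)! : ℝ)⁻¹ * (y - x) ^ (n + 1) * iteratedDeriv (n + 1) f x)
      =o[𝓝 x] fun y ↦ (y - x) ^ (n + 1) := by
  obtain ⟨r, hr, hball⟩ := Metric.eventually_nhds_iff_ball.1
    (hf.eventually (by exact_mod_cast ENat.natCast_ne_coe_top (n + 1)))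
  have hx : x ∈ Metric.ball x r := Metric.mem_ball_self hr
  have hfs : ContDiffOn ℝ (n + 1 : ℕ) f (Metric.ball x r) := fun y hy ↦ by
    exact_mod_cast (hball y hy).contDiffWithinAt
  have hT := taylor_isLittleO (convex_ball x r) hx hfs
  rw [Metric.isOpen_ball.nhdsWithin_eq hx] at hT
  refine hT.congr_left fun y ↦ ?_
  have hzero : ∀ k ∈ Finset.range n, (((k + 1)! : ℝ)⁻¹ * (y - x) ^ (k + 1)) •
      iteratedDerivWithin (k + 1) f (Metric.ball x r) x = 0 := fun k hk ↦ by
    rw [iteratedDerivWithin_of_isOpen Metric.isOpen_ball hx,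
      hcrit (k + 1) (by omega) (Finset.mem_range.1 hk), smul_zero]
  rw [taylor_within_apply, Finset.sum_range_succ, Finset.sum_range_succ',
    Finset.sum_eq_zero hzero,
    iteratedDerivWithin_of_isOpen (n := n + 1) Metric.isOpen_ball hx]
  simp [sub_sub]

open scoped Topology Nat in
/-- Near a critical point of order `n`, increments are bounded below by a multiple of
`|y - x| ^ (n + 1)`. -/
theorem exists_eventually_mul_pow_le_abs_sub {n : ℕ} {x : ℝ} {f : ℝ → ℝ}
    (hf : ContDiffAt ℝ (n + 1) f x)
    (hcrit : ∀ i : ℕ, 1 ≤ i → i ≤ n → iteratedDeriv i f x = 0)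
    (hne : iteratedDeriv (n + 1) f x ≠ 0) :
    ∃ c : ℝ, 0 < c ∧ ∀ᶠ y in 𝓝 x, c * |y - x| ^ (n + 1) ≤ |f x - f y| := by
  set D := iteratedDeriv (n + 1) f x
  have hc : 0 < ((n + 1)! : ℝ)⁻¹ * |D| / 2 := by positivity
  refine ⟨_, hc, ?_⟩
  filter_upwards [(isLittleO_sub_of_iteratedDeriv_eq_zero hf hcrit).bound hc] with y hy
  rw [Real.norm_eq_abs, Real.norm_eq_abs, abs_pow, abs_sub_comm] at hy
  have htri := abs_sub_abs_le_abs_sub (((n + 1)! : ℝ)⁻¹ * (y - x) ^ (n + 1) * D) (f y - f x)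
  rw [abs_mul, abs_mul, abs_pow, abs_of_pos (by positivity : (0 : ℝ) < ((n + 1)! : ℝ)⁻¹)] at htri
  rw [abs_sub_comm (f x)]
  linarith

/-- At a critical point of exact order `n_c` (i.e. `f⁽ⁱ⁾(x) = 0` for `1 ≤ i ≤ n_c`
and `f⁽ⁿᶜ⁺¹⁾(x) ≠ 0`), the baseline smoothness indicator is bounded below by
`c · h^{n_c+1}` for small `h`. -/
theorem baseline_indicator_lower_bound_at_critical_point
    (n_c : ℕ) (x : ℝ) (f : ℝ → ℝ)
    (hf : ContDiffAt ℝ (n_c + 1) f x)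
    (hcrit : ∀ i : ℕ, 1 ≤ i → i ≤ n_c → iteratedDeriv i f x = 0)
    (hne : iteratedDeriv (n_c + 1) f x ≠ 0) :
    ∃ c : ℝ, 0 < c ∧ ∃ h₀ : ℝ, 0 < h₀ ∧ ∀ h : ℝ, 0 < h → h < h₀ →
      c * h ^ (n_c + 1) ≤ IS0 f x h := by
  obtain ⟨c, hc, hev⟩ := exists_eventually_mul_pow_le_abs_sub hf hcrit hne
  obtain ⟨r, hr, hball⟩ := Metric.eventually_nhds_iff.1 hev
  refine ⟨c, hc, r, hr, fun h h_pos hlt ↦ le_min (le_max_of_le_left ?_) (le_max_of_le_left ?_)⟩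
  · simpa [abs_of_pos h_pos] using hball (y := x - h) (by simpa [abs_of_pos h_pos] using hlt)
  · simpa [abs_of_pos h_pos] using hball (y := x + h) (by simpa [abs_of_pos h_pos] using hlt)
end

section
/- Let r ≥ 3 and n_c ≥ 0 be integers with n_c ≤ 2r − 4, let x ∈ ℝ, and let f : ℝ → ℝ be (2r−2)-times continuously differentiable on a neighborhood of x with f⁽ⁱ⁾(x) = 0 for all 1 ≤ i ≤ n_c and f⁽ⁿᶜ⁺¹⁾(x) ≠ 0. Then there exists h₀ > 0 such that for all h ∈ (0, h₀), IS_{r−1,r−1}(f, x, h) < IS₀(f, x, h). Hence, for sufficiently fine meshes, the ENO-MR selection strategy accepts the global (2r−1)-point stencil at any point that is smooth with a critical point of order at most 2r − 4, achieving the designed (2r−1)-th order of accuracy there. -/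
/-- The ENO-MR stencil smoothness indicator `IS_{m,n}`. -/
noncomputable def ISmn (m n : ℕ) (f : ℝ → ℝ) (x h : ℝ) : ℝ :=
  |∑ k ∈ Finset.range (m + n + 1),
      (-1 : ℝ) ^ k * ((m + n).choose k : ℝ) * f (x + ((k : ℝ) - (m : ℝ)) * h)|

open Asymptotics Filter Topology Finset

/-- **Taylor's theorem** with Peano remainder at a point. -/
theorem ContDiffAt.taylor_isLittleO {f : ℝ → ℝ} {x : ℝ} {n : ℕ} (hf : ContDiffAt ℝ n f x) :
    (fun y ↦ f y - ∑ i ∈ range (n + 1), ((i.factorial : ℝ)⁻¹ * (y - x) ^ i) * iteratedDeriv i f x)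
      =o[𝓝 x] fun y ↦ (y - x) ^ n := by
  obtain ⟨u, hu, hfu⟩ := hf.contDiffOn le_rfl (by simp)
  obtain ⟨ε, hε, hball⟩ := Metric.mem_nhds_iff.mp hu
  have hx : x ∈ Metric.ball x ε := Metric.mem_ball_self hε
  have key := _root_.taylor_isLittleO (convex_ball x ε) hx (hfu.mono hball)
  rw [Metric.isOpen_ball.nhdsWithin_eq hx] at key
  refine key.congr_left fun y ↦ ?_
  simp only [taylor_within_apply, smul_eq_mul, iteratedDerivWithin_of_isOpen Metric.isOpen_ball hx]

/-- At a critical point of order `p - 1`, the function is a constant plus a nonzero multiple of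
`t ^ p`, up to a smaller error. -/
theorem ContDiffAt.sub_sub_mul_pow_isLittleO {f : ℝ → ℝ} {x : ℝ} {p : ℕ}
    (hf : ContDiffAt ℝ p f x) (hp : p ≠ 0)
    (hcrit : ∀ i, 1 ≤ i → i < p → iteratedDeriv i f x = 0) :
    (fun t ↦ f (x + t) - f x - iteratedDeriv p f x / p.factorial * t ^ p) =o[𝓝 0]
      fun t ↦ t ^ p := by
  have hx : Tendsto (fun t : ℝ ↦ x + t) (𝓝 0) (𝓝 x) := by
    simpa using (continuous_const_add x).tendsto 0
  refine (hf.taylor_isLittleO.comp_tendsto hx).congr (fun t ↦ ?_) fun t ↦ by simp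
  obtain ⟨q, rfl⟩ := Nat.exists_eq_succ_of_ne_zero hp
  have hsum : ∑ i ∈ range q, (((i + 1).factorial : ℝ)⁻¹ * t ^ (i + 1)) *
      iteratedDeriv (i + 1) f x = 0 :=
    sum_eq_zero fun i hi ↦ by
      rw [hcrit (i + 1) (by omega) (by have := mem_range.mp hi; omega), mul_zero]
  simp only [Function.comp_apply, add_sub_cancel_left]
  rw [sum_range_succ, sum_range_succ', hsum]
  simp
  ring

/-- Alternating binomial sums annihilate polynomials of low degree. -/
theorem sum_neg_one_pow_mul_choose_mul_sub_pow_eq_zero {N p : ℕ} (hp : p < N) (m : ℝ) :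
    ∑ k ∈ range (N + 1), (-1 : ℝ) ^ k * (N.choose k : ℝ) * ((k : ℝ) - m) ^ p = 0 := by
  have h := congrFun (fwdDiff_iter_pow_eq_zero_of_lt (R := ℝ) hp) (-m)
  rw [fwdDiff_iter_eq_sum_shift] at h
  have h2 := congrArg (fun z ↦ (-1 : ℝ) ^ N * z) h
  simp only [mul_sum, Pi.zero_apply, mul_zero] at h2
  rw [← h2]
  refine sum_congr rfl fun k hk ↦ ?_
  have hk : k ≤ N := by simpa [Nat.lt_succ_iff] using hk
  have hsign : (-1 : ℝ) ^ N * (-1) ^ (N - k) = (-1) ^ k := by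
    obtain ⟨d, rfl⟩ := Nat.exists_eq_add_of_le hk
    rw [Nat.add_sub_cancel_left, pow_add, mul_assoc, ← mul_pow]
    simp
  rw [← hsign]
  simp only [zsmul_eq_mul, nsmul_eq_mul, mul_one]
  push_cast
  ring

/-- At a point where `f` is `(2r−2)`-times continuously differentiable and has a
critical point of order `n_c ≤ 2r−4`, the ENO-MR selection strategy accepts the
global `(2r−1)`-point stencil for sufficiently small `h`:
`IS_{r−1,r−1}(f,x,h) < IS₀(f,x,h)`. -/
theorem eno_mr_accepts_global_stencil_at_critical_point
    (r : ℕ) (hr : 3 ≤ r) (n_c : ℕ) (hnc : n_c ≤ 2 * r - 4) (x : ℝ) (f : ℝ → ℝ)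
    (hf : ContDiffAt ℝ (2 * r - 2) f x)
    (hcrit : ∀ i : ℕ, 1 ≤ i → i ≤ n_c → iteratedDeriv i f x = 0)
    (hne : iteratedDeriv (n_c + 1) f x ≠ 0) :
    ∃ h₀ : ℝ, 0 < h₀ ∧ ∀ h : ℝ, 0 < h → h < h₀ →
      ISmn (r - 1) (r - 1) f x h < IS0 f x h := by
  have hf' : ContDiffAt ℝ ((2 * r - 2 : ℕ) : WithTop ℕ∞) f x := by
    convert hf using 1
    norm_cast
  set p := n_c + 1 with hp
  set N := r - 1 + (r - 1) with hN
  have hpN : p < N := by omega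
  have hTaylor := ContDiffAt.sub_sub_mul_pow_isLittleO
    (hf'.of_le (by exact_mod_cast (by omega : p ≤ 2 * r - 2))) (by omega : p ≠ 0)
    fun i h1 h2 ↦ hcrit i h1 (by omega)
  set c := iteratedDeriv p f x / p.factorial
  have hc : 0 < |c| := abs_pos.mpr (div_ne_zero hne (by positivity))
  set g : ℝ → ℝ := fun t ↦ f (x + t) - f x - c * t ^ p with hg
  have hscale (j : ℝ) : (fun h ↦ g (j * h)) =o[𝓝 0] fun h : ℝ ↦ h ^ p := by
    have hj : Tendsto (fun h : ℝ ↦ j * h) (𝓝 0) (𝓝 0) := by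
      simpa using (continuous_const_mul j).tendsto 0
    refine (hTaylor.comp_tendsto hj).trans_isBigO ?_
    simpa only [Function.comp_def, mul_pow] using
      (isBigO_refl (fun h : ℝ ↦ h ^ p) (𝓝 0)).const_mul_left (j ^ p)
  have hstencil (h : ℝ) : ISmn (r - 1) (r - 1) f x h =
      |∑ k ∈ range (N + 1), (-1 : ℝ) ^ k * (N.choose k : ℝ) *
        g (((k : ℝ) - (r - 1 : ℕ)) * h)| := by
    have h0 := sum_neg_one_pow_mul_choose_mul_sub_pow_eq_zero
      (by omega : 0 < N) ((r - 1 : ℕ) : ℝ)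
    have h1 := sum_neg_one_pow_mul_choose_mul_sub_pow_eq_zero hpN ((r - 1 : ℕ) : ℝ)
    rw [ISmn, ← hN, ← sub_zero (∑ k ∈ range _, _), ← mul_zero (f x), ← h0,
      ← sub_zero (_ - _), ← mul_zero (c * h ^ p), ← h1, mul_sum, mul_sum, ← sum_sub_distrib,
      ← sum_sub_distrib]
    refine congrArg _ (sum_congr rfl fun k _ ↦ ?_)
    simp only [hg, mul_pow]
    ring
  have hsmall : (fun h ↦ ∑ k ∈ range (N + 1), (-1 : ℝ) ^ k * (N.choose k : ℝ) *
      g (((k : ℝ) - (r - 1 : ℕ)) * h)) =o[𝓝 0] fun h : ℝ ↦ h ^ p :=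
    IsLittleO.fun_sum fun k _ ↦ (hscale _).const_mul_left _
  have hc4 : 0 < |c| / 4 := by positivity
  obtain ⟨h₀, hh₀, hball⟩ := Metric.eventually_nhds_iff.mp
    (((hsmall.def hc4).and (hTaylor.def hc4)).and ((hscale (-1)).def hc4))
  refine ⟨h₀, hh₀, fun h hpos hlt ↦ ?_⟩
  obtain ⟨⟨hS, hR⟩, hL⟩ := @hball h (by simpa [abs_of_pos hpos] using hlt)
  have hpow : 0 < h ^ p := by positivity
  have hch : 0 < |c| * h ^ p := by positivity
  simp only [Real.norm_eq_abs, abs_of_pos hpow] at hS hR hL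
  rw [hstencil]
  have hright : |c| / 4 * h ^ p < |f x - f (x + h)| := by
    have h1 : |c * h ^ p| ≤ |f x - f (x + h)| + |g h| := by
      rw [show c * h ^ p = -(f x - f (x + h)) - g h by simp only [hg]; ring,
        ← abs_neg (f x - f (x + h))]
      exact abs_sub _ _
    rw [abs_mul, abs_of_pos hpow] at h1
    linarith
  have hleft : |c| / 4 * h ^ p < |f x - f (x - h)| := by
    have h1 : |c * (-1 * h) ^ p| ≤ |f x - f (x - h)| + |g (-1 * h)| := by
      rw [show c * (-1 * h) ^ p = -(f x - f (x - h)) - g (-1 * h) by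
          simp only [hg, show x + -1 * h = x - h by ring]; ring,
        ← abs_neg (f x - f (x - h))]
      exact abs_sub _ _
    rw [abs_mul, abs_pow, abs_mul, abs_neg, abs_one, one_mul, abs_of_pos hpos] at h1
    linarith
  exact hS.trans_lt (lt_min (hleft.trans_le (le_max_left _ _)) (hright.trans_le (le_max_left _ _)))
end

section
/- Let g : ℝ → ℝ be twice continuously differentiable with |g′| ≤ M₁ and |g″| ≤ M₂ on ℝ, let J ∈ ℝ and x_d ∈ ℝ, and define f(x) = g(x) for x < x_d and f(x) = g(x) + J for x ≥ x_d. Then for every x ∈ ℝ and every h > 0, IS₀(f, x, h) ≤ max(M₁·h, M₂·h²). In particular, the baseline smoothness indicator of a piecewise-smooth function with a single jump is O(h), regardless of the location of the jump relative to the grid. -/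
theorem abs_sub_le_of_abs_deriv_le {g : ℝ → ℝ} {M : ℝ} (hg : Differentiable ℝ g)
    (hM : ∀ y, |deriv g y| ≤ M) (x y : ℝ) : |g y - g x| ≤ M * |y - x| :=
  convex_univ.norm_image_sub_le_of_norm_deriv_le (fun z _ => hg z) (fun z _ => hM z)
    (Set.mem_univ x) (Set.mem_univ y)

/-- The second difference of `g` with step `k` is at most `k ^ 2` times a bound on `g''`. -/
theorem abs_second_difference_le {g : ℝ → ℝ} {M : ℝ} (hg : ContDiff ℝ 2 g)
    (hM : ∀ y, |iteratedDeriv 2 g y| ≤ M) (x k : ℝ) :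
    |g x - 2 * g (x + k) + g (x + 2 * k)| ≤ M * k ^ 2 := by
  have hd : Differentiable ℝ g := hg.differentiable (by norm_num)
  have hd' : Differentiable ℝ (deriv g) := by
    simpa using hg.differentiable_iteratedDeriv 1 (by norm_num)
  have hM' : ∀ y, |deriv (deriv g) y| ≤ M := by
    simpa [iteratedDeriv_succ] using hM
  have hφ : ∀ y, HasDerivAt (fun z => g (z + k) - g z) (deriv g (y + k) - deriv g y) y :=
    fun y => ((hd (y + k)).hasDerivAt.comp_add_const y k).sub (hd y).hasDerivAt
  have hbound : ∀ y, |deriv (fun z => g (z + k) - g z) y| ≤ M * |k| := fun y => by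
    rw [(hφ y).deriv]
    simpa using abs_sub_le_of_abs_deriv_le hd' hM' y (y + k)
  have h := abs_sub_le_of_abs_deriv_le (fun y => (hφ y).differentiableAt) hbound x (x + k)
  rw [add_sub_cancel_left, mul_assoc, abs_mul_abs_self, ← sq] at h
  convert h using 2
  ring_nf

/-- For a piecewise-smooth function with a single jump of size `J` at `x_d`, the
baseline smoothness indicator satisfies `IS₀(f,x,h) ≤ max(M₁ h, M₂ h²)` for every
`x` and `h > 0`, regardless of the location of the jump relative to the grid. -/
theorem baseline_indicator_small_at_jump
    (g : ℝ → ℝ) (M₁ M₂ J x_d : ℝ)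
    (hg : ContDiff ℝ 2 g)
    (h1 : ∀ y : ℝ, |deriv g y| ≤ M₁)
    (h2 : ∀ y : ℝ, |iteratedDeriv 2 g y| ≤ M₂)
    (x h : ℝ) (hh : 0 < h) :
    IS0 (fun y => if y < x_d then g y else g y + J) x h ≤ max (M₁ * h) (M₂ * h ^ 2) := by
  have hd : Differentiable ℝ g := hg.differentiable (by norm_num)
  have key : ∀ k : ℝ, |k| = h →
      max |g x - g (x + k)| |g x - 2 * g (x + k) + g (x + 2 * k)| ≤
        max (M₁ * h) (M₂ * h ^ 2) := fun k hk => by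
    apply max_le_max
    · simpa [abs_sub_comm, hk] using abs_sub_le_of_abs_deriv_le hd h1 x (x + k)
    · rw [← hk, sq_abs]
      exact abs_second_difference_le hg h2 x k
  unfold IS0
  rcases lt_or_ge x x_d with hx | hx
  · refine (min_le_left _ _).trans ?_
    have hx₁ : x - h < x_d := by linarith
    have hx₂ : x - 2 * h < x_d := by linarith
    simp only [if_pos hx, if_pos hx₁, if_pos hx₂]
    simpa [← sub_eq_add_neg] using key (-h) (by rw [abs_neg, abs_of_pos hh])
  · refine (min_le_right _ _).trans ?_
    have hx₁ : ¬ x + h < x_d := by linarith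
    have hx₂ : ¬ x + 2 * h < x_d := by linarith
    simp only [if_neg hx.not_gt, if_neg hx₁, if_neg hx₂]
    rw [add_sub_add_right_eq_sub,
      show g x + J - 2 * (g (x + h) + J) + (g (x + 2 * h) + J) =
        g x - 2 * g (x + h) + g (x + 2 * h) by ring]
    exact key h (abs_of_pos hh)
end

section
/- Let g : ℝ → ℝ be continuously differentiable with |g′| ≤ M₁ on ℝ, let J ∈ ℝ and x_d ∈ ℝ, and define f(x) = g(x) for x < x_d and f(x) = g(x) + J for x ≥ x_d. Let m, n ≥ 1 be integers, N = m + n, x ∈ ℝ, h > 0, and suppose there is an integer p with −m ≤ p ≤ n − 1 such that x + p·h < x_d ≤ x + (p+1)·h (the jump lies strictly inside the stencil). Then IS_{m,n}(f, x, h) ≥ |J| − 2^{N−1}·M₁·h. -/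
/-- Summation by parts: an alternating binomial sum of order `M + 1` is an alternating binomial
sum of order `M` of consecutive differences. -/
theorem sum_range_neg_one_pow_mul_choose_succ_mul (M : ℕ) (a : ℕ → ℝ) :
    ∑ k ∈ Finset.range (M + 2), (-1 : ℝ) ^ k * ((M + 1).choose k : ℝ) * a k =
      ∑ k ∈ Finset.range (M + 1), (-1 : ℝ) ^ k * (M.choose k : ℝ) * (a k - a (k + 1)) := by
  have h := Finset.sum_choose_succ_mul (R := ℝ) (fun i _ => (-1) ^ i * a i) M
  calc
    _ = ∑ k ∈ Finset.range (M + 2), ((M + 1).choose k : ℝ) * ((-1) ^ k * a k) :=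
      Finset.sum_congr rfl fun k _ => by ring
    _ = _ := by
      rw [h, ← Finset.sum_add_distrib]
      exact Finset.sum_congr rfl fun k _ => by ring

/-- An alternating binomial sum of terms bounded by `B` is bounded by `2 ^ M * B`. -/
theorem abs_sum_range_neg_one_pow_mul_choose_mul_le (M : ℕ) (d : ℕ → ℝ) (B : ℝ)
    (hd : ∀ k, |d k| ≤ B) :
    |∑ k ∈ Finset.range (M + 1), (-1 : ℝ) ^ k * (M.choose k : ℝ) * d k| ≤ 2 ^ M * B := by
  calc
    _ ≤ ∑ k ∈ Finset.range (M + 1), |(-1 : ℝ) ^ k * (M.choose k : ℝ) * d k| :=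
      Finset.abs_sum_le_sum_abs _ _
    _ ≤ ∑ k ∈ Finset.range (M + 1), (M.choose k : ℝ) * B :=
      Finset.sum_le_sum fun k _ => by
        rw [abs_mul, abs_mul, abs_pow, abs_neg, abs_one, one_pow, one_mul, Nat.abs_cast]
        exact mul_le_mul_of_nonneg_left (hd k) (Nat.cast_nonneg _)
    _ = 2 ^ M * B := by
      rw [← Finset.sum_mul]
      exact_mod_cast congrArg (fun c : ℕ => (c : ℝ) * B) (Nat.sum_range_choose M)

/-- If a candidate stencil strictly contains the jump of a piecewise-smooth function
with `|g′| ≤ M₁`, then its smoothness indicator is at least `|J| − 2^{N−1} M₁ h`,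
where `N = m + n` and `J` is the size of the jump. -/
theorem stencil_indicator_large_at_jump
    (g : ℝ → ℝ) (M₁ J x_d : ℝ)
    (hg : ContDiff ℝ 1 g)
    (h1 : ∀ y : ℝ, |deriv g y| ≤ M₁)
    (m n : ℕ) (hm : 1 ≤ m) (hn : 1 ≤ n)
    (x h : ℝ) (hh : 0 < h)
    (p : ℤ) (hp1 : -(m : ℤ) ≤ p) (hp2 : p ≤ (n : ℤ) - 1)
    (hd1 : x + (p : ℝ) * h < x_d) (hd2 : x_d ≤ x + ((p : ℝ) + 1) * h) :
    |J| - 2 ^ (m + n - 1) * M₁ * h ≤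
      ISmn m n (fun y => if y < x_d then g y else g y + J) x h := by
  obtain ⟨M, hM⟩ : ∃ M, m + n = M + 1 := ⟨m + n - 1, by omega⟩
  obtain ⟨q, hq⟩ : ∃ q : ℕ, (q : ℤ) = p + m := ⟨(p + m).toNat, by omega⟩
  have hqM : q ≤ M := by omega
  have hpq : (p : ℝ) = (q : ℝ) - m := by
    have : (q : ℝ) = p + m := by exact_mod_cast hq
    linarith
  rw [hpq] at hd1 hd2
  have hlip (u v : ℝ) : |g u - g v| ≤ M₁ * |u - v| := by
    simpa only [Real.norm_eq_abs] using
      convex_univ.norm_image_sub_le_of_norm_deriv_le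
        (fun y _ => (hg.differentiable one_ne_zero) y) (fun y _ => h1 y)
        (Set.mem_univ v) (Set.mem_univ u)
  let t (k : ℕ) : ℝ := x + ((k : ℝ) - (m : ℝ)) * h
  have hlt (k : ℕ) : t k < x_d ↔ k ≤ q := by
    constructor
    · intro hk
      by_contra! hkq
      have hkq' : (q : ℝ) + 1 ≤ k := by exact_mod_cast hkq
      have := mul_le_mul_of_nonneg_right hkq' hh.le
      simp only [t] at hk
      linarith
    · intro hkq
      have hkq' : (k : ℝ) ≤ q := by exact_mod_cast hkq
      have := mul_le_mul_of_nonneg_right hkq' hh.le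
      simp only [t]
      linarith
  have hstep (k : ℕ) : |g (t k) - g (t (k + 1))| ≤ M₁ * h := by
    have ht : t k - t (k + 1) = -h := by simp only [t]; push_cast; ring
    simpa only [ht, abs_neg, abs_of_pos hh] using hlip (t k) (t (k + 1))
  let f (y : ℝ) : ℝ := if y < x_d then g y else g y + J
  have hjump (k : ℕ) :
      f (t k) - f (t (k + 1)) = (g (t k) - g (t (k + 1))) - if k = q then J else 0 := by
    simp only [f, hlt]
    split_ifs <;> first | omega | ring
  have hsum : ∑ k ∈ Finset.range (M + 2), (-1 : ℝ) ^ k * ((M + 1).choose k : ℝ) * f (t k) =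
      ∑ k ∈ Finset.range (M + 1), (-1 : ℝ) ^ k * (M.choose k : ℝ) * (g (t k) - g (t (k + 1))) -
        (-1 : ℝ) ^ q * (M.choose q : ℝ) * J := by
    rw [sum_range_neg_one_pow_mul_choose_succ_mul M (fun k => f (t k))]
    simp only [hjump, mul_sub _ (_ - _), Finset.sum_sub_distrib, mul_ite, mul_zero]
    rw [Finset.sum_ite_eq', if_pos (Finset.mem_range.2 (by omega))]
  have hJ : |J| ≤ |(-1 : ℝ) ^ q * (M.choose q : ℝ) * J| := by
    rw [abs_mul, abs_mul, abs_pow, abs_neg, abs_one, one_pow, one_mul, Nat.abs_cast]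
    exact le_mul_of_one_le_left (abs_nonneg J) (by exact_mod_cast Nat.choose_pos hqM)
  have hsmooth := abs_sum_range_neg_one_pow_mul_choose_mul_le M _ _ hstep
  change _ ≤ |∑ k ∈ Finset.range (m + n + 1),
    (-1 : ℝ) ^ k * ((m + n).choose k : ℝ) * f (t k)|
  rw [hM, hsum, abs_sub_comm, Nat.add_sub_cancel, mul_assoc]
  exact (sub_le_sub hJ hsmooth).trans (abs_sub_abs_le_abs_sub _ _)
end

section
/- Let g : ℝ → ℝ be twice continuously differentiable with |g′| ≤ M₁ and |g″| ≤ M₂ on ℝ, let J ≠ 0, x_d ∈ ℝ, and define f(x) = g(x) for x < x_d and f(x) = g(x) + J for x ≥ x_d. Fix an integer N_max ≥ 2. Then there exists h₀ > 0, depending only on M₁, M₂, |J| and N_max, such that for every h ∈ (0, h₀), every x ∈ ℝ, and all integers m, n ≥ 1 with m + n ≤ N_max for which there is an integer p with −m ≤ p ≤ n − 1 and x + p·h < x_d ≤ x + (p+1)·h, one has IS_{m,n}(f, x, h) > IS₀(f, x, h). Hence, for sufficiently fine meshes, the ENO-MR selection strategy rejects every candidate stencil that contains the discontinuity, i.e.,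 the scheme has the ENO property. -/
/-- A finite difference of order `N + 1` across a jump of size `J`, taken of values within `B` of a
constant, has size at least `|J| - 2 ^ (N + 1) * B`. -/
theorem abs_jump_sub_le_abs_alternating_sum {N r : ℕ} (hr : r ≤ N) {u : ℕ → ℝ} {c B : ℝ} (J : ℝ)
    (hu : ∀ k ≤ N + 1, |u k - c| ≤ B) :
    |J| - 2 ^ (N + 1) * B ≤
      |∑ k ∈ Finset.range (N + 1 + 1),
        (-1 : ℝ) ^ k * ((N + 1).choose k : ℝ) * if k ≤ r then u k else u k + J| := by
  have h_total : ∑ k ∈ Finset.range (N + 1 + 1), (-1 : ℝ) ^ k * ((N + 1).choose k : ℝ) = 0 := by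
    exact_mod_cast Int.alternating_sum_range_choose_of_ne (Nat.succ_ne_zero N)
  have h_partial : ∑ k ∈ Finset.range (N + 1 + 1),
      (if k ≤ r then (-1 : ℝ) ^ k * ((N + 1).choose k : ℝ) else 0) = (-1) ^ r * N.choose r := by
    have h_filter : (Finset.range (N + 1 + 1)).filter (· ≤ r) = Finset.range (r + 1) := by
      ext k
      simp only [Finset.mem_filter, Finset.mem_range]
      omega
    rw [← Finset.sum_filter, h_filter]
    exact_mod_cast Int.alternating_sum_range_choose_eq_choose (n := N) (m := r)
  have h_smooth : |∑ k ∈ Finset.range (N + 1 + 1),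
      (-1 : ℝ) ^ k * ((N + 1).choose k : ℝ) * (u k - c)| ≤ 2 ^ (N + 1) * B := by
    calc _ ≤ ∑ k ∈ Finset.range (N + 1 + 1), ((N + 1).choose k : ℝ) * B := by
          refine (Finset.abs_sum_le_sum_abs _ _).trans (Finset.sum_le_sum fun k hk => ?_)
          rw [abs_mul, abs_mul, abs_pow, abs_neg, abs_one, one_pow, one_mul, Nat.abs_cast]
          exact mul_le_mul_of_nonneg_left (hu k (Nat.lt_succ_iff.1 (Finset.mem_range.1 hk)))
            (Nat.cast_nonneg _)
      _ = 2 ^ (N + 1) * B := by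
          rw [← Finset.sum_mul]
          congr 1
          exact_mod_cast Nat.sum_range_choose (N + 1)
  have h_jump : |J| ≤ |J * ((-1) ^ r * N.choose r)| := by
    rw [abs_mul, abs_mul, abs_pow, abs_neg, abs_one, one_pow, one_mul, Nat.abs_cast]
    exact le_mul_of_one_le_right (abs_nonneg J) (by exact_mod_cast Nat.choose_pos hr)
  have h_split : ∑ k ∈ Finset.range (N + 1 + 1),
        ((-1 : ℝ) ^ k * ((N + 1).choose k : ℝ) * if k ≤ r then u k else u k + J) =
      (∑ k ∈ Finset.range (N + 1 + 1), (-1 : ℝ) ^ k * ((N + 1).choose k : ℝ) * (u k - c)) -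
        J * ((-1) ^ r * N.choose r) := by
    calc _ = (∑ k ∈ Finset.range (N + 1 + 1), (-1 : ℝ) ^ k * ((N + 1).choose k : ℝ) * (u k - c)) +
          (c + J) * (∑ k ∈ Finset.range (N + 1 + 1), (-1 : ℝ) ^ k * ((N + 1).choose k : ℝ)) -
          J * ∑ k ∈ Finset.range (N + 1 + 1),
            (if k ≤ r then (-1 : ℝ) ^ k * ((N + 1).choose k : ℝ) else 0) := by
          rw [Finset.mul_sum, Finset.mul_sum, ← Finset.sum_add_distrib, ← Finset.sum_sub_distrib]
          refine Finset.sum_congr rfl fun k _ => ?_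
          split_ifs <;> ring
      _ = _ := by rw [h_total, h_partial, mul_zero, add_zero]
  rw [h_split, abs_sub_comm]
  linarith [abs_sub_abs_le_abs_sub (J * ((-1) ^ r * N.choose r)) (∑ k ∈ Finset.range (N + 1 + 1),
    (-1 : ℝ) ^ k * ((N + 1).choose k : ℝ) * (u k - c))]

/-- One-sided first and second differences of step `d` of a function with Lipschitz constant `M`
are at most `2 * (M * |d|)`. -/
theorem max_abs_differences_le {g : ℝ → ℝ} {M : ℝ} (hg : ∀ y z, |g y - g z| ≤ M * |y - z|)
    (x d : ℝ) :
    max |g x - g (x + d)| |g x - 2 * g (x + d) + g (x + 2 * d)| ≤ 2 * (M * |d|) := by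
  have h₁ : |g x - g (x + d)| ≤ M * |d| := by
    simpa using hg x (x + d)
  have h₂ : |g (x + 2 * d) - g (x + d)| ≤ M * |d| := by
    convert hg (x + 2 * d) (x + d) using 3
    ring
  have h_nonneg : 0 ≤ M * |d| := (abs_nonneg _).trans h₁
  rw [abs_le] at h₁ h₂
  exact max_le (abs_le.2 ⟨by linarith, by linarith⟩) (abs_le.2 ⟨by linarith, by linarith⟩)

/-- The baseline indicator of a function with one jump is at most that of its smooth part,
since the jump misses one of the two one-sided stencils. -/
theorem IS0_jump_le {g : ℝ → ℝ} {M : ℝ} (hg : ∀ y z, |g y - g z| ≤ M * |y - z|) (J x_d x : ℝ)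
    {h : ℝ} (hh : 0 < h) :
    IS0 (fun y => if y < x_d then g y else g y + J) x h ≤ 2 * (M * h) := by
  unfold IS0
  by_cases hx : x < x_d
  · refine (min_le_left _ _).trans ?_
    have h₁ : x - h < x_d := by linarith
    have h₂ : x - 2 * h < x_d := by linarith
    simp only [hx, h₁, h₂, if_true]
    simpa [← sub_eq_add_neg, abs_of_pos hh] using max_abs_differences_le hg x (-h)
  · refine (min_le_right _ _).trans ?_
    have h₁ : ¬ x + h < x_d := by linarith
    have h₂ : ¬ x + 2 * h < x_d := by linarith
    simp only [hx, h₁, h₂, if_false]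
    rw [add_sub_add_right_eq_sub,
      show g x + J - 2 * (g (x + h) + J) + (g (x + 2 * h) + J) =
        g x - 2 * g (x + h) + g (x + 2 * h) by ring]
    simpa [abs_of_pos hh] using max_abs_differences_le hg x h

/-- The indicator of a stencil containing the jump `J` is bounded below by `|J|`, up to the
oscillation of the smooth part. -/
theorem le_ISmn_jump {g : ℝ → ℝ} {M : ℝ} (hg : ∀ y z, |g y - g z| ≤ M * |y - z|) (hM : 0 ≤ M)
    (J : ℝ) {x_d x h : ℝ} (hh : 0 < h) {m n : ℕ} {p : ℤ} (hmp : -(m : ℤ) ≤ p)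
    (hpn : p ≤ (n : ℤ) - 1) (hl : x + (p : ℝ) * h < x_d) (hr : x_d ≤ x + ((p : ℝ) + 1) * h) :
    |J| - 2 ^ (m + n) * (M * ((m + n : ℕ) * h)) ≤
      ISmn m n (fun y => if y < x_d then g y else g y + J) x h := by
  obtain ⟨r, hr_eq⟩ := Int.eq_ofNat_of_zero_le (show 0 ≤ p + m by omega)
  obtain ⟨N, hN⟩ : ∃ N, m + n = N + 1 := ⟨m + n - 1, by omega⟩
  have hp : (p : ℝ) = r - m := by
    rw [eq_sub_iff_add_eq]
    exact_mod_cast hr_eq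
  have h_side : ∀ k : ℕ, x + ((k : ℝ) - m) * h < x_d ↔ k ≤ r := by
    intro k
    constructor
    · intro hk
      by_contra! hlt
      have hcast : (r : ℝ) + 1 ≤ k := by exact_mod_cast hlt
      have := mul_le_mul_of_nonneg_right (show (p : ℝ) + 1 ≤ k - m by linarith) hh.le
      linarith
    · intro hk
      have hcast : (k : ℝ) ≤ r := by exact_mod_cast hk
      have := mul_le_mul_of_nonneg_right (show (k : ℝ) - m ≤ p by linarith) hh.le
      linarith
  unfold ISmn
  simp only [h_side]
  rw [hN]
  refine abs_jump_sub_le_abs_alternating_sum (u := fun k => g (x + ((k : ℝ) - m) * h)) (c := g x)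
    (by omega) J fun k hk => (hg _ _).trans (mul_le_mul_of_nonneg_left ?_ hM)
  rw [add_sub_cancel_left, abs_mul, abs_of_pos hh]
  refine mul_le_mul_of_nonneg_right ?_ hh.le
  have hk' : (k : ℝ) ≤ (N + 1 : ℕ) := by exact_mod_cast hk
  have hm' : (m : ℝ) ≤ (N + 1 : ℕ) := by exact_mod_cast (show m ≤ N + 1 by omega)
  exact abs_le.2 ⟨by linarith [(Nat.cast_nonneg k : (0 : ℝ) ≤ k)],
    by linarith [(Nat.cast_nonneg m : (0 : ℝ) ≤ m)]⟩

/-- ENO property of the ENO-MR selection strategy: for a piecewise-smooth function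
with a single nonzero jump, there is a mesh threshold `h₀` depending only on
`M₁, M₂, |J|` and `N_max` such that for every finer mesh, every candidate stencil
with `m, n ≥ 1` and `m + n ≤ N_max` that contains the discontinuity is rejected:
`IS₀(f,x,h) < IS_{m,n}(f,x,h)`. -/
theorem eno_mr_rejects_stencils_containing_jump
    (M₁ M₂ J : ℝ) (hJ : J ≠ 0) (N_max : ℕ) (hN : 2 ≤ N_max) :
    ∃ h₀ : ℝ, 0 < h₀ ∧ ∀ (g : ℝ → ℝ) (x_d : ℝ),
      ContDiff ℝ 2 g →
      (∀ y : ℝ, |deriv g y| ≤ M₁) →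
      (∀ y : ℝ, |iteratedDeriv 2 g y| ≤ M₂) →
      ∀ h : ℝ, 0 < h → h < h₀ → ∀ x : ℝ, ∀ m n : ℕ, 1 ≤ m → 1 ≤ n → m + n ≤ N_max →
      (∃ p : ℤ, -(m : ℤ) ≤ p ∧ p ≤ (n : ℤ) - 1 ∧
        x + (p : ℝ) * h < x_d ∧ x_d ≤ x + ((p : ℝ) + 1) * h) →
      IS0 (fun y => if y < x_d then g y else g y + J) x h <
        ISmn m n (fun y => if y < x_d then g y else g y + J) x h := by
  set K : ℝ := 2 + 2 ^ N_max * N_max with hK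
  have hK_pos : 0 < K := by positivity
  have hM_pos : 0 < |M₁| + 1 := by positivity
  refine ⟨|J| / (K * (|M₁| + 1)), by positivity, ?_⟩
  rintro g x_d hg hg' - h hh hh₀ x m n - - hmn ⟨p, hmp, hpn, hl, hr⟩
  have hM₁ : 0 ≤ M₁ := (abs_nonneg _).trans (hg' 0)
  have h_lip : ∀ y z, |g y - g z| ≤ M₁ * |y - z| := fun y z =>
    convex_univ.norm_image_sub_le_of_norm_deriv_le
      (fun w _ => hg.differentiable (by norm_num) w) (fun w _ => hg' w) (Set.mem_univ z)
      (Set.mem_univ y)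
  refine (IS0_jump_le h_lip J x_d x hh).trans_lt
    (lt_of_lt_of_le ?_ (le_ISmn_jump h_lip hM₁ J hh hmp hpn hl hr))
  have h_coeff : (2 : ℝ) ^ (m + n) * (m + n : ℕ) ≤ 2 ^ N_max * N_max := by
    gcongr
    norm_num
  have h_small : h * (K * (|M₁| + 1)) < |J| := (lt_div_iff₀ (by positivity)).1 hh₀
  rw [abs_of_nonneg hM₁] at h_small
  have h_scaled := mul_le_mul_of_nonneg_right h_coeff (mul_nonneg hM₁ hh.le)
  have h_extra : 0 < K * h := mul_pos hK_pos hh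
  have h_expand : h * (K * (M₁ + 1)) =
      2 * (M₁ * h) + 2 ^ N_max * N_max * (M₁ * h) + K * h := by
    rw [hK]
    ring
  linarith
end
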